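/- Consider the random graph G(n, m) with m = m(n) edges, where λ_n := 2m/n → λ for some λ > 0, and for k ≥ 0 let N_k = N_k(n) be the number of vertices of degree k. Then for every fixed K ≥ 0, the random vector (n^{-1/2}(N_k − n π_{λ_n}(k)))_{k=0}^{K} converges in distribution to a centered Gaussian vector (Ũ_0,…,Ũ_K) with covariances Cov(Ũ_j, Ũ_k) = π_λ(j) π_λ(k) (−(j−λ)(k−λ)/λ − 1) + π_λ(k) δ_{jk}. -/

import Mathlib

open MeasureTheory ProbabilityTheory Filter Topology

noncomputable section

/-- Convergence in distribution (weak convergence of laws): integrals of every bounded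
continuous function converge. -/
def TendstoInDistribution {E : Type*} [MeasurableSpace E] [TopologicalSpace E]
    (μs : ℕ → Measure E) (μ : Measure E) : Prop :=
  ∀ f : BoundedContinuousFunction E ℝ,
    Tendsto (fun n => ∫ x, f x ∂(μs n)) atTop (𝓝 (∫ x, f x ∂μ))

/-- `κ` is a version of the conditional distribution of the first coordinate given the
second coordinate, for the joint law `μ`: it is a Markov kernel which disintegrates `μ`. -/
def IsCondLaw {E F : Type*} [MeasurableSpace E] [MeasurableSpace F]
    (μ : Measure (E × F)) (κ : Kernel F E) : Prop :=
  IsMarkovKernel κ ∧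
  ∀ s : Set E, ∀ t : Set F, MeasurableSet s → MeasurableSet t →
    μ (s ×ˢ t) = ∫⁻ z in t, κ z s ∂(μ.map Prod.snd)

/-- A family of measures `κ z` (conditional distributions) is stochastically increasing:
`P(X ≤ x | Y = z)` is weakly decreasing in `z`. -/
def StochIncrFam {E F : Type*} [MeasurableSpace E] [Preorder E] [Preorder F]
    (κ : F → Measure E) : Prop :=
  ∀ z₁ z₂ : F, z₁ ≤ z₂ → ∀ x : E, κ z₂ {w | w ≤ x} ≤ κ z₁ {w | w ≤ x}

/-- A family of measures `κ z` is stochastically decreasing: `P(X ≥ x | Y = z)` is weakly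
decreasing in `z` (equivalently, `-X` is stochastically increasing). -/
def StochDecrFam {E F : Type*} [MeasurableSpace E] [Preorder E] [Preorder F]
    (κ : F → Measure E) : Prop :=
  ∀ z₁ z₂ : F, z₁ ≤ z₂ → ∀ x : E, κ z₂ {w | x ≤ w} ≤ κ z₁ {w | x ≤ w}

/-- Covariance of two real functionals under a measure. -/
def covFn {E : Type*} [MeasurableSpace E] (μ : Measure E) (f g : E → ℝ) : ℝ :=
  ∫ x, f x * g x ∂μ - (∫ x, f x ∂μ) * (∫ x, g x ∂μ)

/-- A measure on a real normed space is Gaussian (jointly normal, possibly degenerate) if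
every continuous linear functional pushes it forward to a one-dimensional Gaussian law. -/
def IsGaussianMeasure {E : Type*} [NormedAddCommGroup E] [NormedSpace ℝ E]
    [MeasurableSpace E] (μ : Measure E) : Prop :=
  ∀ L : E →L[ℝ] ℝ, ∃ m : ℝ, ∃ v : NNReal, μ.map (fun x => L x) = gaussianReal m v

open scoped ENNReal

/-- The index type for potential edges of a graph on `Fin n`: unordered pairs of distinct
vertices. -/
abbrev EdgeIdx (n : ℕ) := {e : Sym2 (Fin n) // ¬ e.IsDiag}

/-- The Erdős–Rényi measure `G(n,p)`: each potential edge is present independently with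
probability `p`; a graph is encoded as its edge indicator `S : EdgeIdx n → Bool`. -/
def gnpMeasure (n : ℕ) (p : ℝ) : Measure (EdgeIdx n → Bool) :=
  ∑ S : EdgeIdx n → Bool,
    (∏ e : EdgeIdx n, if S e then ENNReal.ofReal p else ENNReal.ofReal (1 - p)) •
      Measure.dirac S

/-- The number of edges of the graph `S`. -/
def edgeCount (n : ℕ) (S : EdgeIdx n → Bool) : ℕ :=
  (Finset.univ.filter fun e : EdgeIdx n => S e = true).card

/-- The uniform measure `G(n,m)` on graphs on `Fin n` with exactly `m` edges. -/
def gnmMeasure (n m : ℕ) : Measure (EdgeIdx n → Bool) :=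
  ∑ S : EdgeIdx n → Bool,
    (if edgeCount n S = m then
        ((Finset.univ.filter fun S' : EdgeIdx n → Bool => edgeCount n S' = m).card :
          ℝ≥0∞)⁻¹
      else 0) • Measure.dirac S

/-- The degree of the vertex `v` in the graph `S`. -/
def degree (n : ℕ) (S : EdgeIdx n → Bool) (v : Fin n) : ℕ :=
  (Finset.univ.filter fun e : EdgeIdx n => S e = true ∧ v ∈ (e : Sym2 (Fin n))).card

/-- The number of vertices of degree `k` in the graph `S`. -/
def degCount (n : ℕ) (k : ℕ) (S : EdgeIdx n → Bool) : ℕ :=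
  (Finset.univ.filter fun v : Fin n => degree n S v = k).card

/-- The Poisson point probabilities `π_λ(k) = e^{-λ} λ^k / k!`. -/
def poissonProb (lam : ℝ) (k : ℕ) : ℝ :=
  Real.exp (-lam) * lam ^ k / (k.factorial : ℝ)


/-- One uniformly random ball is thrown into `n` boxes: averaging operator. -/
def avgOp (n : ℕ) (h : (Fin n → ℕ) → ℂ) (d : Fin n → ℕ) : ℂ :=
  (n : ℂ)⁻¹ * ∑ u : Fin n, h (d + Pi.single u 1)

/-- Adding one ball changes `h` by at most `C`. -/
def LipBall (n : ℕ) (C : ℝ) (h : (Fin n → ℕ) → ℂ) : Prop :=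
  ∀ d u, ‖h (d + Pi.single u 1) - h d‖ ≤ C

/-- Average over all graphs with `r` edges of a function of the degree sequence. -/
def avgG (n r : ℕ) (h : (Fin n → ℕ) → ℂ) : ℂ :=
  ((Finset.univ.filter fun S : EdgeIdx n → Bool => edgeCount n S = r).card : ℂ)⁻¹ *
    ∑ S ∈ Finset.univ.filter (fun S : EdgeIdx n → Bool => edgeCount n S = r), h (degree n S)

/-- Degree vector of a single edge. -/
def dvec (n : ℕ) (e : Sym2 (Fin n)) (v : Fin n) : ℕ := if v ∈ e then 1 else 0

lemma dvec_mk (n : ℕ) (u v : Fin n) (h : u ≠ v) :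
    dvec n s(u, v) = Pi.single u 1 + Pi.single v 1 := by
  funext w
  simp only [dvec, Sym2.mem_iff, Pi.add_apply, Pi.single_apply]
  split_ifs <;> simp_all

lemma avgOp_lip {n : ℕ} (hn : 0 < n) {C : ℝ} {h : (Fin n → ℕ) → ℂ} (hh : LipBall n C h) :
    LipBall n C (avgOp n h) := by
  intro d u
  unfold avgOp
  rw [← mul_sub, ← Finset.sum_sub_distrib, norm_mul]
  have : ‖∑ x : Fin n, (h (d + Pi.single u 1 + Pi.single x 1) - h (d + Pi.single x 1))‖ ≤ n * C := by
    refine (norm_sum_le _ _).trans ?_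
    refine (Finset.sum_le_sum (g := fun _ => C) fun x _ => ?_).trans ?_
    · have := hh (d + Pi.single x 1) u
      rwa [add_right_comm] at this
    · simp
  calc _ ≤ ‖(n : ℂ)⁻¹‖ * (n * C) := by gcongr
    _ = C := by
      have : (n : ℝ) ≠ 0 := by positivity
      simp; field_simp

lemma pair_sum (n : ℕ) (F : Fin n → Fin n → ℂ) (E : Sym2 (Fin n) → ℂ)
    (hE : ∀ u v, u ≠ v → F u v = E s(u, v)) :
    ∑ u, ∑ v, F u v = 2 * ∑ e : EdgeIdx n, E e + ∑ u, F u u := by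
  classical
  have h1 : ∑ e : EdgeIdx n, E e = ∑ p ∈ (Finset.univ : Finset (Fin n × Fin n)) with p.1 < p.2,
      E s(p.1, p.2) := by
    have := Finset.sum_sym2_filter_not_isDiag (Finset.univ : Finset (Fin n)) E
    rw [Finset.sum_subtype (p := fun e : Sym2 (Fin n) => ¬ e.IsDiag) (F := inferInstance)] at this
    · rw [this]
      apply Finset.sum_congr _ (fun _ _ => rfl)
      ext p
      simp only [Finset.mem_filter, Finset.mem_offDiag, Finset.mem_univ, true_and]
      constructor
      · exact fun h => h.2
      · exact fun h => ⟨h.ne, h⟩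
    · intro e; simp
  have h2 : ∑ p ∈ (Finset.univ : Finset (Fin n × Fin n)) with p.1 < p.2, E s(p.1, p.2)
      = ∑ p ∈ (Finset.univ : Finset (Fin n × Fin n)) with p.2 < p.1, E s(p.1, p.2) := by
    refine Finset.sum_nbij' (fun p => p.swap) (fun p => p.swap) ?_ ?_ ?_ ?_ ?_ <;>
      simp [Sym2.eq_swap]
  have h3 : ∑ u, F u u = ∑ p ∈ (Finset.univ : Finset (Fin n × Fin n)) with p.1 = p.2,
      F p.1 p.2 := by
    refine Finset.sum_nbij' (fun u => (u, u)) (fun p => p.1) ?_ ?_ ?_ ?_ ?_ <;> simp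
  rw [two_mul]
  nth_rw 2 [h1]
  rw [h2, h1, h3, ← Fintype.sum_prod_type']
  simp only [Finset.sum_filter, ← Finset.sum_add_distrib]
  apply Finset.sum_congr rfl
  rintro ⟨u, v⟩ -
  rcases lt_trichotomy u v with h | h | h
  · simp [h, h.ne, h.not_gt, hE u v h.ne]
  · simp [h]
  · simp [h, h.ne', h.not_gt, hE u v h.ne']

lemma card_edge (n : ℕ) : (n : ℝ) * n = 2 * (Fintype.card (EdgeIdx n) : ℝ) + n := by
  have := pair_sum n (fun _ _ => 1) (fun _ => 1) (fun _ _ _ => rfl)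
  simp only [Finset.sum_const, Finset.card_univ, Fintype.card_fin] at this
  simp only [nsmul_eq_mul, mul_one] at this
  exact_mod_cast this

lemma edgeCount_le (n : ℕ) (S : EdgeIdx n → Bool) : edgeCount n S ≤ Fintype.card (EdgeIdx n) := by
  unfold edgeCount; exact Finset.card_le_univ _

lemma filter_update (n : ℕ) (S : EdgeIdx n → Bool) (e : EdgeIdx n) (he : S e = false)
    (P : EdgeIdx n → Prop) [DecidablePred P] :
    (Finset.univ.filter fun x : EdgeIdx n => Function.update S e true x = true ∧ P x).card
      = (Finset.univ.filter fun x : EdgeIdx n => S x = true ∧ P x).card + if P e then 1 else 0 := by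
  classical
  rw [Finset.card_filter, Finset.card_filter]
  have : (if P e then 1 else 0) = ∑ x : EdgeIdx n, if x = e then (if P x then 1 else 0) else 0 := by
    simp
  rw [this, ← Finset.sum_add_distrib]
  apply Finset.sum_congr rfl
  intro x _
  by_cases hx : x = e
  · subst hx; simp [he]
  · simp [hx]

lemma edgeCount_update (n : ℕ) (S : EdgeIdx n → Bool) (e : EdgeIdx n) (he : S e = false) :
    edgeCount n (Function.update S e true) = edgeCount n S + 1 := by
  have := filter_update n S e he (fun _ => True)
  simpa [edgeCount] using this

lemma degree_update (n : ℕ) (S : EdgeIdx n → Bool) (e : EdgeIdx n) (he : S e = false) :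
    degree n (Function.update S e true) = degree n S + dvec n e := by
  funext v
  have := filter_update n S e he (fun x => v ∈ (x : Sym2 (Fin n)))
  simpa only [degree, dvec, Pi.add_apply] using this

lemma double_count (n r : ℕ) (f : (EdgeIdx n → Bool) → ℂ) :
    ∑ S ∈ Finset.univ.filter (fun S : EdgeIdx n → Bool => edgeCount n S = r),
      ∑ e ∈ Finset.univ.filter (fun e : EdgeIdx n => S e = false), f (Function.update S e true)
    = (r + 1) * ∑ S ∈ Finset.univ.filter (fun S : EdgeIdx n → Bool => edgeCount n S = r + 1), f S := by
  classical
  have h1 : (r + 1 : ℂ) * ∑ S ∈ Finset.univ.filter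
      (fun S : EdgeIdx n → Bool => edgeCount n S = r + 1), f S =
      ∑ S ∈ Finset.univ.filter (fun S : EdgeIdx n → Bool => edgeCount n S = r + 1),
      ∑ e ∈ Finset.univ.filter (fun e : EdgeIdx n => S e = true), f S := by
    rw [Finset.mul_sum]
    apply Finset.sum_congr rfl
    intro S hS
    simp only [Finset.mem_filter, Finset.mem_univ, true_and] at hS
    rw [Finset.sum_const, nsmul_eq_mul]
    have : ((Finset.univ.filter (fun e : EdgeIdx n => S e = true)).card : ℂ) = r + 1 := by
      have h := hS
      unfold edgeCount at h
      rw [h]; push_cast; ring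
    rw [this]
  rw [h1, Finset.sum_sigma', Finset.sum_sigma']
  refine Finset.sum_bij' (fun p _ => ⟨Function.update p.1 p.2 true, p.2⟩)
    (fun p _ => ⟨Function.update p.1 p.2 false, p.2⟩) ?_ ?_ ?_ ?_ ?_
  · rintro ⟨S, e⟩ h
    simp only [Finset.mem_sigma, Finset.mem_filter, Finset.mem_univ, true_and] at h ⊢
    exact ⟨by rw [edgeCount_update n S e h.2, h.1], by simp⟩
  · rintro ⟨S, e⟩ h
    simp only [Finset.mem_sigma, Finset.mem_filter, Finset.mem_univ, true_and] at h ⊢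
    have := edgeCount_update n (Function.update S e false) e (by simp)
    rw [Function.update_idem, ← h.2, Function.update_eq_self, h.1] at this
    exact ⟨by omega, by simp⟩
  · rintro ⟨S, e⟩ h
    simp only [Finset.mem_sigma, Finset.mem_filter, Finset.mem_univ, true_and] at h
    simp only [Function.update_idem]
    rw [← h.2, Function.update_eq_self]
  · rintro ⟨S, e⟩ h
    simp only [Finset.mem_sigma, Finset.mem_filter, Finset.mem_univ, true_and] at h
    simp only [Function.update_idem]
    rw [← h.2, Function.update_eq_self]
  · rintro ⟨S, e⟩ h
    rfl

lemma card_false (n : ℕ) (S : EdgeIdx n → Bool) :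
    ((Finset.univ.filter (fun e : EdgeIdx n => S e = false)).card : ℝ) =
      Fintype.card (EdgeIdx n) - edgeCount n S := by
  have := Finset.card_filter_add_card_filter_not (s := (Finset.univ : Finset (EdgeIdx n)))
    (fun e : EdgeIdx n => S e = true)
  simp only [Bool.not_eq_true, Finset.card_univ] at this
  unfold edgeCount
  rw [← this]; push_cast; ring

lemma graph_card (n r : ℕ) :
    ((Fintype.card (EdgeIdx n) : ℂ) - r) *
      (Finset.univ.filter fun S : EdgeIdx n → Bool => edgeCount n S = r).card
    = (r + 1) * (Finset.univ.filter fun S : EdgeIdx n → Bool => edgeCount n S = r + 1).card := by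
  have := double_count n r (fun _ => 1)
  rw [Finset.sum_const, nsmul_eq_mul, mul_one] at this
  rw [← this, mul_comm, ← nsmul_eq_mul, ← Finset.sum_const]
  apply Finset.sum_congr rfl
  intro S hS
  simp only [Finset.mem_filter, Finset.mem_univ, true_and] at hS
  rw [Finset.sum_const, nsmul_eq_mul, mul_one]
  have := card_false n S
  rw [hS] at this
  exact_mod_cast this.symm

lemma graph_card_pos (n r : ℕ) (hr : r ≤ Fintype.card (EdgeIdx n)) :
    0 < (Finset.univ.filter fun S : EdgeIdx n → Bool => edgeCount n S = r).card := by
  classical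
  obtain ⟨T, -, hT⟩ := Finset.exists_subset_card_eq (s := (Finset.univ : Finset (EdgeIdx n)))
    (n := r) (by simpa using hr)
  refine Finset.card_pos.2 ⟨fun e => decide (e ∈ T), ?_⟩
  refine Finset.mem_filter.2 ⟨Finset.mem_univ _, ?_⟩
  unfold edgeCount
  rw [← hT]
  congr 1
  ext e
  simp

lemma local_step (n r : ℕ) (hn : 0 < n) (hr : r < Fintype.card (EdgeIdx n)) {C : ℝ}
    {h : (Fin n → ℕ) → ℂ} (hh : LipBall n C h) (S : EdgeIdx n → Bool) (hS : edgeCount n S = r) :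
    ‖((Fintype.card (EdgeIdx n) : ℂ) - r)⁻¹ *
        ∑ e ∈ Finset.univ.filter (fun e : EdgeIdx n => S e = false), h (degree n S + dvec n e)
      - avgOp n (avgOp n h) (degree n S)‖ ≤ 4 * C * (n + 2 * r) / n ^ 2 := by
  set d := degree n S with hd
  set N := Fintype.card (EdgeIdx n) with hN
  have hC : 0 ≤ C := (norm_nonneg _).trans (hh d ⟨0, hn⟩)
  have hnn : (n : ℂ) ≠ 0 := by exact_mod_cast hn.ne'
  have hNr : ((N : ℂ) - r) ≠ 0 := by
    rw [sub_ne_zero]; exact_mod_cast hr.ne'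
  have hNr' : (0 : ℝ) < N - r := by
    rw [sub_pos]; exact_mod_cast hr
  have two : ∀ u v, ‖h (d + Pi.single u 1 + Pi.single v 1) - h d‖ ≤ 2 * C := by
    intro u v
    have h1 := hh d u
    have h2 := hh (d + Pi.single u 1) v
    calc _ = ‖(h (d + Pi.single u 1 + Pi.single v 1) - h (d + Pi.single u 1)) +
          (h (d + Pi.single u 1) - h d)‖ := by congr 1; ring
      _ ≤ _ := norm_add_le _ _
      _ ≤ _ := by linarith
  have two' : ∀ e : EdgeIdx n, ‖h (d + dvec n e) - h d‖ ≤ 2 * C := by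
    rintro ⟨e, he⟩
    induction e with | h u v => ?_
    have huv : u ≠ v := by simpa using he
    simp only
    rw [dvec_mk n u v huv, ← add_assoc]
    exact two u v
  set T0 := Finset.univ.filter (fun e : EdgeIdx n => S e = false) with hT0
  set T1 := Finset.univ.filter (fun e : EdgeIdx n => S e = true) with hT1
  have c0 : (T0.card : ℝ) = N - r := by rw [hT0, card_false, hS]
  have c1 : (T1.card : ℝ) = r := by rw [← hS]; rfl
  set a := ∑ e ∈ T0, (h (d + dvec n e) - h d) with ha
  set b := ∑ e ∈ T1, (h (d + dvec n e) - h d) with hb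
  set l := ∑ u, (h (d + Pi.single u 1 + Pi.single u 1) - h d) with hl
  have na : ‖a‖ ≤ (N - r) * (2 * C) := by
    rw [← c0, ← nsmul_eq_mul, ← Finset.sum_const]
    exact (norm_sum_le _ _).trans (Finset.sum_le_sum fun e _ => two' e)
  have nb : ‖b‖ ≤ r * (2 * C) := by
    rw [← c1, ← nsmul_eq_mul, ← Finset.sum_const]
    exact (norm_sum_le _ _).trans (Finset.sum_le_sum fun e _ => two' e)
  have nl : ‖l‖ ≤ n * (2 * C) := by
    refine (norm_sum_le _ _).trans ((Finset.sum_le_sum fun e _ => two e e).trans ?_)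
    simp
  have hab : a + b = ∑ e : EdgeIdx n, (h (d + dvec n e) - h d) := by
    rw [ha, hb, add_comm, ← Finset.sum_filter_add_sum_filter_not Finset.univ
      (fun e : EdgeIdx n => S e = true)]
    simp [hT0, hT1]
  have e1 : ((N : ℂ) - r)⁻¹ * ∑ e ∈ T0, h (d + dvec n e) = h d + ((N : ℂ) - r)⁻¹ * a := by
    rw [ha, Finset.sum_sub_distrib, Finset.sum_const, nsmul_eq_mul]
    have : (T0.card : ℂ) = N - r := by exact_mod_cast c0
    rw [this]; field_simp; ring
  have e2 : avgOp n (avgOp n h) d = h d + ((n : ℂ) ^ 2)⁻¹ * (2 * (a + b) + l) := by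
    have hps := pair_sum n (fun u v => h (d + Pi.single u 1 + Pi.single v 1) - h d)
      (fun e => h (d + dvec n e) - h d)
      (fun u v huv => by rw [dvec_mk n u v huv, ← add_assoc])
    rw [hab, hl, ← hps]
    unfold avgOp
    simp only [Finset.sum_sub_distrib, Finset.sum_const, Finset.card_univ, Fintype.card_fin,
      nsmul_eq_mul, ← Finset.mul_sum]
    field_simp; ring
  have hnn' : (0 : ℝ) < n := by exact_mod_cast hn
  have ce := card_edge n
  have hcoef : ((N : ℝ) - r)⁻¹ - 2 / n ^ 2 = (n + 2 * r) / (n ^ 2 * (N - r)) := by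
    field_simp
    rw [← hN] at ce
    linear_combination ce
  have e3 : ((N : ℂ) - r)⁻¹ * ∑ e ∈ T0, h (d + dvec n e) - avgOp n (avgOp n h) d
      = ((((N : ℝ) - r)⁻¹ - 2 / n ^ 2 : ℝ) : ℂ) * a - ((2 / n ^ 2 : ℝ) : ℂ) * b
        - ((1 / n ^ 2 : ℝ) : ℂ) * l := by
    rw [e1, e2]; push_cast; field_simp; ring
  rw [e3, hcoef]
  refine (norm_sub_le _ _).trans ((add_le_add_left (norm_sub_le _ _) _).trans ?_)
  rw [norm_mul, norm_mul, norm_mul, Complex.norm_real, Complex.norm_real, Complex.norm_real,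
    Real.norm_of_nonneg (by positivity), Real.norm_of_nonneg (by positivity),
    Real.norm_of_nonneg (by positivity)]
  calc _ ≤ (n + 2 * r) / (n ^ 2 * (N - r)) * ((N - r) * (2 * C)) + 2 / n ^ 2 * (r * (2 * C))
        + 1 / n ^ 2 * (n * (2 * C)) := by gcongr
    _ = _ := by field_simp; ring

lemma one_step (n r : ℕ) (hn : 0 < n) (hr : r < Fintype.card (EdgeIdx n)) {C : ℝ}
    {h : (Fin n → ℕ) → ℂ} (hh : LipBall n C h) :
    ‖avgG n (r + 1) h - avgG n r (avgOp n (avgOp n h))‖ ≤ 4 * C * (n + 2 * r) / n ^ 2 := by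
  set c := (Finset.univ.filter fun S : EdgeIdx n → Bool => edgeCount n S = r).card with hc
  have hcpos : 0 < c := graph_card_pos n r hr.le
  have hNr : ((Fintype.card (EdgeIdx n) : ℂ) - r) ≠ 0 := by
    rw [sub_ne_zero]; exact_mod_cast hr.ne'
  have hc0 : (c : ℂ) ≠ 0 := by exact_mod_cast hcpos.ne'
  have hr1 : ((r : ℂ) + 1) ≠ 0 := by exact_mod_cast (Nat.succ_ne_zero r)
  have e1 : avgG n (r + 1) h = (c : ℂ)⁻¹ * ∑ S ∈ Finset.univ.filter
      (fun S : EdgeIdx n → Bool => edgeCount n S = r), ((Fintype.card (EdgeIdx n) : ℂ) - r)⁻¹ *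
        ∑ e ∈ Finset.univ.filter (fun e : EdgeIdx n => S e = false), h (degree n S + dvec n e) := by
    have hgc := graph_card n r
    have dc := double_count n r (fun S => h (degree n S))
    rw [← Finset.mul_sum]
    have : ∑ S ∈ Finset.univ.filter (fun S : EdgeIdx n → Bool => edgeCount n S = r),
        ∑ e ∈ Finset.univ.filter (fun e : EdgeIdx n => S e = false), h (degree n S + dvec n e) =
        ∑ S ∈ Finset.univ.filter (fun S : EdgeIdx n → Bool => edgeCount n S = r),
        ∑ e ∈ Finset.univ.filter (fun e : EdgeIdx n => S e = false),
          h (degree n (Function.update S e true)) := by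
      refine Finset.sum_congr rfl fun S _ => Finset.sum_congr rfl fun e he => ?_
      rw [degree_update n S e (by simpa using he)]
    rw [this, dc]
    unfold avgG
    rw [← hc] at hgc
    have hc1 : ((Finset.univ.filter fun S : EdgeIdx n → Bool =>
        edgeCount n S = r + 1).card : ℂ) ≠ 0 := by
      exact_mod_cast (graph_card_pos n (r + 1) hr).ne'
    field_simp
    linear_combination (∑ S ∈ Finset.univ.filter
      (fun S : EdgeIdx n → Bool => edgeCount n S = r + 1), h (degree n S)) * hgc
  have e2 : avgG n r (avgOp n (avgOp n h)) = (c : ℂ)⁻¹ * ∑ S ∈ Finset.univ.filter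
      (fun S : EdgeIdx n → Bool => edgeCount n S = r), avgOp n (avgOp n h) (degree n S) := rfl
  rw [e1, e2, ← mul_sub, ← Finset.sum_sub_distrib, norm_mul, norm_inv, Complex.norm_natCast]
  have hcR : (0 : ℝ) < c := by exact_mod_cast hcpos
  rw [inv_mul_le_iff₀ hcR, hc, ← nsmul_eq_mul, ← Finset.sum_const]
  refine (norm_sum_le _ _).trans (Finset.sum_le_sum fun S hS => ?_)
  exact local_step n r hn hr hh S (by simpa using hS)

lemma avgG_zero (n : ℕ) (h : (Fin n → ℕ) → ℂ) : avgG n 0 h = h 0 := by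
  have : (Finset.univ.filter fun S : EdgeIdx n → Bool => edgeCount n S = 0) = {fun _ => false} := by
    ext S
    simp only [Finset.mem_filter, Finset.mem_univ, true_and, Finset.mem_singleton, edgeCount,
      Finset.card_eq_zero, Finset.filter_eq_empty_iff, funext_iff]
    simp
  unfold avgG
  rw [this]
  simp only [Finset.card_singleton, Finset.sum_singleton, Nat.cast_one, inv_one, one_mul]
  congr 1
  funext v
  simp [degree]

/-- Comparison of `G(n,m)` with `2m` independent balls. -/
lemma gnm_compare (n m : ℕ) (hn : 0 < n) (hm : m ≤ Fintype.card (EdgeIdx n)) {C : ℝ}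
    {h : (Fin n → ℕ) → ℂ} (hh : LipBall n C h) :
    ‖avgG n m h - (avgOp n)^[2 * m] h 0‖ ≤ m * (4 * C * (n + 2 * m) / n ^ 2) := by
  induction m generalizing h with
  | zero => simp [avgG_zero]
  | succ m ih =>
    have hC : 0 ≤ C := (norm_nonneg _).trans (hh 0 ⟨0, hn⟩)
    have h1 := one_step n m hn (by omega) hh
    have h2 := ih (by omega) (avgOp_lip hn (avgOp_lip hn hh))
    have e : (avgOp n)^[2 * (m + 1)] h 0 = (avgOp n)^[2 * m] (avgOp n (avgOp n h)) 0 := by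
      rw [show 2 * (m + 1) = 2 * m + 1 + 1 by ring, Function.iterate_succ_apply,
        Function.iterate_succ_apply]
    rw [e]
    have hmono : 4 * C * (n + 2 * m) / n ^ 2 ≤ 4 * C * (n + 2 * ((m + 1 : ℕ) : ℝ)) / n ^ 2 := by
      push_cast; gcongr; linarith
    have hmono2 := mul_le_mul_of_nonneg_left hmono (Nat.cast_nonneg (α := ℝ) m)
    have := norm_add_le (avgG n (m + 1) h - avgG n m (avgOp n (avgOp n h)))
      (avgG n m (avgOp n (avgOp n h)) - (avgOp n)^[2 * m] (avgOp n (avgOp n h)) 0)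
    rw [sub_add_sub_cancel] at this
    refine this.trans ?_
    push_cast at *
    linarith

/-- Exponential generating function (shifted by `d`) of a sequence `g` with `g k = 1` for `k > K`. -/
def Gf (K : ℕ) (g : ℕ → ℂ) (d : ℕ) (z : ℂ) : ℂ :=
  Complex.exp z + ∑ j ∈ Finset.range (K + 1), (g (d + j) - 1) * z ^ j / (j.factorial : ℂ)

lemma Gf_zero (K : ℕ) (g : ℕ → ℂ) (d : ℕ) : Gf K g d 0 = g d := by
  unfold Gf
  rw [Finset.sum_range_succ']
  simp

lemma Gf_contDiff (K : ℕ) (g : ℕ → ℂ) (d : ℕ) (N : ℕ) : ContDiff ℂ N (Gf K g d) := by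
  unfold Gf
  fun_prop

lemma Gf_hasDerivAt (K : ℕ) (g : ℕ → ℂ) (hg : ∀ k, K < k → g k = 1) (d : ℕ) (z : ℂ) :
    HasDerivAt (Gf K g d) (Gf K g (d + 1) z) z := by
  unfold Gf
  refine (Complex.hasDerivAt_exp z).add ?_
  have h1 : HasDerivAt (fun z : ℂ => ∑ j ∈ Finset.range (K + 1),
      (g (d + j) - 1) * z ^ j / (j.factorial : ℂ))
      (∑ j ∈ Finset.range (K + 1), (g (d + j) - 1) * (j * z ^ (j - 1)) / (j.factorial : ℂ)) z := by
    refine HasDerivAt.fun_sum fun j _ => ?_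
    exact ((hasDerivAt_pow j z).const_mul _).div_const _
  convert! h1 using 1
  rw [Finset.sum_range_succ, hg (d + 1 + K) (by omega), Finset.sum_range_succ']
  simp only [sub_self, zero_mul, zero_div, add_zero, Nat.cast_zero, mul_zero]
  refine Finset.sum_congr rfl fun j _ => ?_
  rw [Nat.factorial_succ, add_assoc, add_comm 1 j, Nat.add_sub_cancel]
  have : ((j : ℂ) + 1) ≠ 0 := by exact_mod_cast Nat.succ_ne_zero j
  have : ((j.factorial : ℕ) : ℂ) ≠ 0 := by exact_mod_cast j.factorial_ne_zero
  push_cast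
  field_simp

lemma multinomial_iter (n : ℕ) (hn : 0 < n) (K : ℕ) (g : ℕ → ℂ) (hg : ∀ k, K < k → g k = 1)
    (M : ℕ) (d : Fin n → ℕ) :
    (n : ℂ) ^ M * (avgOp n)^[M] (fun d => ∏ v, g (d v)) d =
      iteratedDeriv M (fun z => ∏ v, Gf K g (d v) z) 0 := by
  induction M generalizing d with
  | zero => simp [Gf_zero]
  | succ M ih =>
    have hnn : (n : ℂ) ≠ 0 := by exact_mod_cast hn.ne'
    have hder : deriv (fun z => ∏ v, Gf K g (d v) z) =
        fun z => ∑ u : Fin n, ∏ v, Gf K g ((d + Pi.single u 1 : Fin n → ℕ) v) z := by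
      funext z
      rw [(HasDerivAt.fun_finsetProd
        (fun v _ => Gf_hasDerivAt K g hg (d v) z)).deriv]
      refine Finset.sum_congr rfl fun u _ => ?_
      rw [← Finset.mul_prod_erase Finset.univ _ (Finset.mem_univ u), smul_eq_mul, mul_comm]
      congr 1
      · simp
      · refine Finset.prod_congr rfl fun v hv => ?_
        simp [(Finset.mem_erase.1 hv).1]
    rw [iteratedDeriv_succ', hder, iteratedDeriv_fun_sum]
    · simp_rw [← ih]
      rw [Function.iterate_succ_apply', ← Finset.mul_sum, avgOp, pow_succ]
      field_simp
    · intro u _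
      have : ContDiff ℂ M (fun z => ∏ v, Gf K g ((d + Pi.single u 1 : Fin n → ℕ) v) z) :=
        contDiff_prod fun v _ => Gf_contDiff K g _ M
      exact this.contDiffAt

lemma cauchy_formula (n : ℕ) (hn : 0 < n) (K : ℕ) (g : ℕ → ℂ) (hg : ∀ k, K < k → g k = 1)
    (M : ℕ) (r : ℝ) (hr : 0 < r) :
    (avgOp n)^[M] (fun d => ∏ v, g (d v)) 0 =
      ((M.factorial : ℂ) / ((n : ℂ) ^ M * (r : ℂ) ^ M * (2 * Real.pi))) *
        ∫ θ in (-Real.pi)..Real.pi, Gf K g 0 (r * Complex.exp (θ * Complex.I)) ^ n *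
          Complex.exp (-(M * θ * Complex.I)) := by
  have h1 := multinomial_iter n hn K g hg M 0
  simp only [Pi.zero_apply, Finset.prod_const, Finset.card_univ, Fintype.card_fin] at h1
  have hd : DifferentiableOn ℂ (fun z => Gf K g 0 z ^ n) (Metric.closedBall 0 r) := by
    have : Differentiable ℂ (Gf K g 0) := fun z => (Gf_hasDerivAt K g hg 0 z).differentiableAt
    exact (this.pow n).differentiableOn
  have h2 := hd.circleIntegral_one_div_sub_center_pow_smul hr M
  rw [← h1, circleIntegral] at h2
  have hrc : (r : ℂ) ≠ 0 := by exact_mod_cast hr.ne'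
  have h3 : ∀ θ : ℝ, deriv (circleMap 0 r) θ • ((1 / (circleMap 0 r θ - 0) ^ (M + 1)) •
      Gf K g 0 (circleMap 0 r θ) ^ n) = (Complex.I / (r : ℂ) ^ M) *
      (Gf K g 0 (r * Complex.exp (θ * Complex.I)) ^ n *
          Complex.exp (-(M * θ * Complex.I))) := by
    intro θ
    have he := Complex.exp_ne_zero (θ * Complex.I)
    have : Complex.exp (-(M * θ * Complex.I)) = (Complex.exp (θ * Complex.I) ^ M)⁻¹ := by
      rw [← Complex.exp_nat_mul, ← Complex.exp_neg]; congr 1; ring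
    rw [this, deriv_circleMap]
    simp only [circleMap, smul_eq_mul, sub_zero, zero_add]
    rw [pow_succ, mul_pow]
    field_simp
  simp_rw [h3] at h2
  rw [intervalIntegral.integral_const_mul] at h2
  have hper : Function.Periodic (fun θ : ℝ => Gf K g 0 (r * Complex.exp (θ * Complex.I)) ^ n *
          Complex.exp (-(M * θ * Complex.I))) (2 * Real.pi) := by
    intro θ
    have e1 : Complex.exp (((θ + 2 * Real.pi : ℝ) : ℂ) * Complex.I) =
        Complex.exp (θ * Complex.I) := by
      push_cast
      rw [add_mul, Complex.exp_periodic]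
    have e2 : ∀ θ : ℝ, Complex.exp (-(M * θ * Complex.I)) =
        (Complex.exp (θ * Complex.I) ^ M)⁻¹ := by
      intro θ
      rw [← Complex.exp_nat_mul, ← Complex.exp_neg]; congr 1; ring
    simp only [e2, e1]
  have h4 := hper.intervalIntegral_add_eq (-Real.pi) 0
  rw [show -Real.pi + 2 * Real.pi = Real.pi by ring, zero_add] at h4
  rw [h4]
  set J := ∫ θ in (0 : ℝ)..(2 * Real.pi), Gf K g 0 (r * Complex.exp (θ * Complex.I)) ^ n *
          Complex.exp (-(M * θ * Complex.I)) with hJ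
  have hnn : (n : ℂ) ≠ 0 := by exact_mod_cast hn.ne'
  have hpi : (Real.pi : ℂ) ≠ 0 := by exact_mod_cast Real.pi_ne_zero
  have hM : ((M.factorial : ℕ) : ℂ) ≠ 0 := by exact_mod_cast M.factorial_ne_zero
  have hI := Complex.I_ne_zero
  rw [smul_eq_mul] at h2
  field_simp at h2 ⊢
  linear_combination -h2

lemma norm_two_le (p q θ : ℝ) (hp : 0 < p) (hq : 0 < q) :
    ‖(p : ℂ) + q * Complex.exp (θ * Complex.I)‖ ≤ p + q - p * q / (p + q) * (1 - Real.cos θ) := by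
  have hc1 := Real.cos_le_one θ
  have hc2 := Real.neg_one_le_cos θ
  have hsq : ‖(p : ℂ) + q * Complex.exp (θ * Complex.I)‖ ^ 2 =
      (p + q) ^ 2 - 2 * (p * q) * (1 - Real.cos θ) := by
    rw [← Complex.normSq_eq_norm_sq, Complex.exp_mul_I, Complex.normSq_apply]
    have e1 : ((p : ℂ) + q * (Complex.cos θ + Complex.sin θ * Complex.I)).re = p + q * Real.cos θ := by
      simp [← Complex.ofReal_cos, ← Complex.ofReal_sin]
    have e2 : ((p : ℂ) + q * (Complex.cos θ + Complex.sin θ * Complex.I)).im = q * Real.sin θ := by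
      simp [← Complex.ofReal_cos, ← Complex.ofReal_sin]
    rw [e1, e2]
    have := Real.sin_sq_add_cos_sq θ
    linear_combination q ^ 2 * this
  have hpq : 0 < p + q := by positivity
  have hw : p * q / (p + q) * (p + q) = p * q := by field_simp
  have hw0 : 0 < p * q / (p + q) := by positivity
  have hw1 : p * q / (p + q) * 2 ≤ p + q := by
    rw [div_mul_eq_mul_div, div_le_iff₀ hpq]; nlinarith [sq_nonneg (p - q)]
  set w := p * q / (p + q) with hwdef
  have hnn : 0 ≤ p + q - w * (1 - Real.cos θ) := by nlinarith
  refine le_of_sq_le_sq ?_ hnn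
  rw [hsq, ← hw]
  nlinarith [sq_nonneg (w * (1 - Real.cos θ))]

/-- Constant in the Gaussian bound. -/
def cc (K : ℕ) (r : ℝ) : ℝ :=
  Real.exp (-r) * ((r ^ (K + 1) / ((K + 1).factorial : ℝ)) * (r ^ (K + 2) / ((K + 2).factorial : ℝ)) /
    (r ^ (K + 1) / ((K + 1).factorial : ℝ) + r ^ (K + 2) / ((K + 2).factorial : ℝ)))

lemma cc_pos (K : ℕ) (r : ℝ) (hr : 0 < r) : 0 < cc K r := by
  unfold cc; positivity

lemma cc_cont (K : ℕ) (r : ℝ) (hr : 0 < r) : ContinuousAt (cc K) r := by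
  unfold cc
  refine ContinuousAt.mul (by fun_prop) (ContinuousAt.div (by fun_prop) (by fun_prop) ?_)
  positivity

lemma Gf_bound (K : ℕ) (g : ℕ → ℂ) (hg : ∀ k, ‖g k‖ ≤ 1) (r θ : ℝ)
    (hr : 0 < r) :
    ‖(Real.exp (-r) : ℂ) * Gf K g 0 (r * Complex.exp (θ * Complex.I))‖ ≤
      1 - cc K r * (1 - Real.cos θ) := by
  set z : ℂ := r * Complex.exp (θ * Complex.I) with hz
  have hnz : ‖z‖ = r := by
    rw [hz, norm_mul, Complex.norm_exp_ofReal_mul_I, Complex.norm_real, mul_one,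
      Real.norm_of_nonneg hr.le]
  set p := r ^ (K + 1) / ((K + 1).factorial : ℝ) with hp
  set q := r ^ (K + 2) / ((K + 2).factorial : ℝ) with hq
  have hp0 : 0 < p := by positivity
  have hq0 : 0 < q := by positivity
  have e1 : Gf K g 0 z = ∑ j ∈ Finset.range (K + 1), g j * (z ^ j / (j.factorial : ℂ)) +
      (z ^ (K + 1) / ((K + 1).factorial : ℂ) + z ^ (K + 2) / ((K + 2).factorial : ℂ)) +
      (Complex.exp z - ∑ j ∈ Finset.range (K + 3), z ^ j / (j.factorial : ℂ)) := by
    unfold Gf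
    rw [Finset.sum_range_succ _ (K + 2), Finset.sum_range_succ _ (K + 1)]
    simp only [zero_add, sub_mul, one_mul, sub_div, Finset.sum_sub_distrib, mul_div_assoc]
    ring
  have e2 : z ^ (K + 1) / ((K + 1).factorial : ℂ) + z ^ (K + 2) / ((K + 2).factorial : ℂ) =
      Complex.exp (θ * Complex.I) ^ (K + 1) * ((p : ℂ) + q * Complex.exp (θ * Complex.I)) := by
    rw [hz, hp, hq]; push_cast; ring
  have b1 : ‖∑ j ∈ Finset.range (K + 1), g j * (z ^ j / (j.factorial : ℂ))‖ ≤
      ∑ j ∈ Finset.range (K + 1), r ^ j / (j.factorial : ℝ) := by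
    refine (norm_sum_le _ _).trans (Finset.sum_le_sum fun j _ => ?_)
    rw [norm_mul, norm_div, norm_pow, hnz, Complex.norm_natCast]
    exact mul_le_of_le_one_left (by positivity) (hg j)
  have b2 : ‖Complex.exp (θ * Complex.I) ^ (K + 1) * ((p : ℂ) + q * Complex.exp (θ * Complex.I))‖ ≤
      p + q - p * q / (p + q) * (1 - Real.cos θ) := by
    rw [norm_mul, norm_pow, Complex.norm_exp_ofReal_mul_I, one_pow, one_mul]
    exact norm_two_le p q θ hp0 hq0
  have b3 := Complex.norm_exp_sub_sum_le_exp_norm_sub_sum z (K + 3)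
  rw [hnz, Finset.sum_range_succ (fun j => r ^ j / (j.factorial : ℝ)) (K + 2),
    Finset.sum_range_succ (fun j => r ^ j / (j.factorial : ℝ)) (K + 1)] at b3
  have b4 : ‖Gf K g 0 z‖ ≤ Real.exp r - p * q / (p + q) * (1 - Real.cos θ) := by
    rw [e1, e2]
    refine (norm_add_le _ _).trans ?_
    have := norm_add_le (∑ j ∈ Finset.range (K + 1), g j * (z ^ j / (j.factorial : ℂ)))
      (Complex.exp (θ * Complex.I) ^ (K + 1) * ((p : ℂ) + q * Complex.exp (θ * Complex.I)))
    linarith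
  rw [norm_mul, Complex.norm_real, Real.norm_of_nonneg (Real.exp_pos _).le]
  calc _ ≤ Real.exp (-r) * (Real.exp r - p * q / (p + q) * (1 - Real.cos θ)) := by gcongr
    _ = _ := by
      rw [mul_sub, ← Real.exp_add]; simp [cc]; ring

lemma exp_second (y : ℕ → ℂ) (b : ℂ)
    (hy : Tendsto (fun n : ℕ => ((Real.sqrt n : ℝ) : ℂ) * y n) atTop (𝓝 b)) :
    Tendsto (fun n : ℕ => (n : ℂ) * (Complex.exp (y n) - 1 - y n)) atTop (𝓝 (b ^ 2 / 2)) := by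
  have hs : Tendsto (fun n : ℕ => Real.sqrt n) atTop atTop :=
    Real.tendsto_sqrt_atTop.comp tendsto_natCast_atTop_atTop
  have hsi : Tendsto (fun n : ℕ => (((Real.sqrt n)⁻¹ : ℝ) : ℂ)) atTop (𝓝 0) := by
    have := (Complex.continuous_ofReal.tendsto 0).comp hs.inv_tendsto_atTop
    simpa [Function.comp_def] using this
  have hy0 : Tendsto y atTop (𝓝 0) := by
    have := hsi.mul hy
    rw [zero_mul] at this
    refine this.congr' ?_
    filter_upwards [eventually_gt_atTop 0] with n hn
    have : ((Real.sqrt n : ℝ) : ℂ) ≠ 0 := by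
      exact_mod_cast (Real.sqrt_pos.2 (by exact_mod_cast hn)).ne'
    push_cast
    field_simp
  have hsq : ∀ n : ℕ, ((Real.sqrt n : ℝ) : ℂ) ^ 2 = n := by
    intro n
    rw [← Complex.ofReal_pow, Real.sq_sqrt (Nat.cast_nonneg n)]; simp
  have hmain : Tendsto (fun n : ℕ => (n : ℂ) * (Complex.exp (y n) - 1 - y n - y n ^ 2 / 2)) atTop
      (𝓝 0) := by
    have hb : Tendsto (fun n : ℕ => ‖((Real.sqrt n : ℝ) : ℂ) * y n‖ ^ 2 *
        (‖y n‖ * Real.exp ‖y n‖)) atTop (𝓝 0) := by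
      have h1 := hy0.norm
      have h2 := (Real.continuous_exp.tendsto _).comp h1
      have := (hy.norm.pow 2).mul (h1.mul h2)
      simpa using this
    refine squeeze_zero_norm (fun n => ?_) hb
    have := Complex.norm_exp_sub_sum_le_norm_mul_exp (y n) 3
    simp only [Finset.sum_range_succ, Finset.sum_range_zero, zero_add, pow_zero, pow_one,
      Nat.factorial] at this
    norm_num at this
    rw [norm_mul, norm_mul, mul_pow, ← norm_pow, hsq]
    have e : Complex.exp (y n) - 1 - y n - y n ^ 2 / 2 =
      Complex.exp (y n) - (1 + y n + y n ^ 2 / 2) := by ring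
    rw [e]
    calc _ ≤ ‖(n : ℂ)‖ * (‖y n‖ ^ 3 * Real.exp ‖y n‖) := by gcongr
      _ = _ := by ring
  have h2 := ((hy.pow 2).div_const 2).add hmain
  rw [add_zero] at h2
  refine h2.congr fun n => ?_
  rw [mul_pow, hsq]; ring

lemma exp_first (y : ℕ → ℂ) (b : ℂ)
    (hy : Tendsto (fun n : ℕ => ((Real.sqrt n : ℝ) : ℂ) * y n) atTop (𝓝 b)) :
    Tendsto (fun n : ℕ => ((Real.sqrt n : ℝ) : ℂ) * (Complex.exp (y n) - 1)) atTop (𝓝 b) := by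
  have hs : Tendsto (fun n : ℕ => Real.sqrt n) atTop atTop :=
    Real.tendsto_sqrt_atTop.comp tendsto_natCast_atTop_atTop
  have hsi : Tendsto (fun n : ℕ => (((Real.sqrt n)⁻¹ : ℝ) : ℂ)) atTop (𝓝 0) := by
    have := (Complex.continuous_ofReal.tendsto 0).comp hs.inv_tendsto_atTop
    simpa [Function.comp_def] using this
  have h := hy.add (hsi.mul (exp_second y b hy))
  rw [zero_mul, add_zero] at h
  refine h.congr' ?_
  filter_upwards [eventually_gt_atTop 0] with n hn
  have h0 : ((Real.sqrt n : ℝ) : ℂ) ≠ 0 := by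
    exact_mod_cast (Real.sqrt_pos.2 (by exact_mod_cast hn)).ne'
  have hsq : ((Real.sqrt n : ℝ) : ℂ) * ((Real.sqrt n : ℝ) : ℂ) = n := by
    rw [← Complex.ofReal_mul, Real.mul_self_sqrt (Nat.cast_nonneg n)]; simp
  rw [← hsq]
  push_cast
  field_simp
  ring

/-- Mean of `t` under the Poisson law. -/
def mu (K : ℕ) (t : ℕ → ℝ) (r : ℝ) : ℝ := ∑ k ∈ Finset.range (K + 1), poissonProb r k * t k

/-- The centered joint characteristic function. -/
def Fn (K : ℕ) (t : ℕ → ℝ) (r ε x : ℝ) : ℂ :=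
  (Real.exp (-r) : ℂ) * Gf K (fun k => Complex.exp (Complex.I * (ε * t k))) 0
    (r * Complex.exp ((ε * x : ℝ) * Complex.I)) *
  Complex.exp (-(Complex.I * (ε * (mu K t r + x * r))))

/-- The quadratic exponent. -/
def quad (K : ℕ) (t : ℕ → ℝ) (r x : ℝ) : ℝ :=
  r * x ^ 2 + 2 * x * (∑ k ∈ Finset.range (K + 1), k * poissonProb r k * t k - mu K t r * r) +
    (∑ k ∈ Finset.range (K + 1), poissonProb r k * t k ^ 2 - mu K t r ^ 2)

lemma poissonProb_cont (k : ℕ) : Continuous (fun r => poissonProb r k) := by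
  unfold poissonProb; fun_prop

lemma Fn_eq (K : ℕ) (t : ℕ → ℝ) (r ε x : ℝ) :
    Fn K t r ε x = (Complex.exp (r * (Complex.exp (Complex.I * (ε * x)) - 1)) +
      ∑ k ∈ Finset.range (K + 1), (poissonProb r k : ℂ) * (Complex.exp (Complex.I * (ε * t k)) - 1) *
        Complex.exp (Complex.I * (ε * x) * k)) *
      Complex.exp (-(Complex.I * (ε * (mu K t r + x * r)))) := by
  unfold Fn Gf
  congr 1
  rw [mul_add]
  have e0 : Complex.exp ((ε * x : ℝ) * Complex.I) = Complex.exp (Complex.I * (ε * x)) := by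
    congr 1; push_cast; ring
  rw [e0]
  congr 1
  · rw [Complex.ofReal_exp, ← Complex.exp_add]; congr 1; push_cast; ring
  · rw [Finset.mul_sum]
    refine Finset.sum_congr rfl fun k _ => ?_
    rw [mul_comm _ (k : ℂ), Complex.exp_nat_mul]
    simp only [poissonProb, zero_add]
    push_cast
    ring

lemma Fn_limit (K : ℕ) (t : ℕ → ℝ) (r : ℕ → ℝ) (lam x : ℝ) (hr : Tendsto r atTop (𝓝 lam)) :
    Tendsto (fun n : ℕ => Fn K t (r n) (Real.sqrt n)⁻¹ x ^ n) atTop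
      (𝓝 (Complex.exp (-(quad K t lam x / 2 : ℝ)))) := by
  have hs0 : ∀ᶠ n : ℕ in atTop, ((Real.sqrt n : ℝ) : ℂ) ≠ 0 := by
    filter_upwards [eventually_gt_atTop 0] with n hn
    exact_mod_cast (Real.sqrt_pos.2 (by exact_mod_cast hn)).ne'
  have hsq : ∀ n : ℕ, ((Real.sqrt n : ℝ) : ℂ) * ((Real.sqrt n : ℝ) : ℂ) = n := by
    intro n
    rw [← Complex.ofReal_mul, Real.mul_self_sqrt (Nat.cast_nonneg n)]; simp
  have hsi : Tendsto (fun n : ℕ => (((Real.sqrt n)⁻¹ : ℝ) : ℂ)) atTop (𝓝 0) := by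
    have hs : Tendsto (fun n : ℕ => Real.sqrt n) atTop atTop :=
      Real.tendsto_sqrt_atTop.comp tendsto_natCast_atTop_atTop
    have := (Complex.continuous_ofReal.tendsto 0).comp hs.inv_tendsto_atTop
    simpa [Function.comp_def] using this
  have hrc : Tendsto (fun n => (r n : ℂ)) atTop (𝓝 lam) :=
    (Complex.continuous_ofReal.tendsto _).comp hr
  have hpc : ∀ k, Tendsto (fun n => (poissonProb (r n) k : ℂ)) atTop (𝓝 (poissonProb lam k)) :=
    fun k => (Complex.continuous_ofReal.tendsto _).comp (((poissonProb_cont k).tendsto _).comp hr)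
  have hmu : Tendsto (fun n => (mu K t (r n) : ℂ)) atTop (𝓝 (mu K t lam)) := by
    have : Continuous (fun r => mu K t r) := by
      unfold mu
      exact continuous_finsetSum _ fun k _ => (poissonProb_cont k).mul continuous_const
    exact (Complex.continuous_ofReal.tendsto _).comp ((this.tendsto _).comp hr)
  -- linear sequences
  have lin : ∀ (a : ℕ → ℂ) (b : ℂ), Tendsto a atTop (𝓝 b) →
      Tendsto (fun n : ℕ => ((Real.sqrt n : ℝ) : ℂ) * (Complex.I * ((((Real.sqrt n)⁻¹ : ℝ) : ℂ) * a n)))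
        atTop (𝓝 (Complex.I * b)) := by
    intro a b hab
    refine (hab.const_mul Complex.I).congr' ?_
    filter_upwards [hs0] with n hn
    push_cast
    field_simp
  have Lx := lin (fun _ => (x : ℂ)) x tendsto_const_nhds
  have Lt := fun k => lin (fun _ => (t k : ℂ)) (t k) tendsto_const_nhds
  have Lm := lin (fun n => (mu K t (r n) : ℂ) + x * r n) (mu K t lam + x * lam)
    (hmu.add (hrc.const_mul _))
  have Lxk : ∀ k : ℕ, Tendsto (fun n : ℕ => ((Real.sqrt n : ℝ) : ℂ) *
      (Complex.I * ((((Real.sqrt n)⁻¹ : ℝ) : ℂ) * x) * k)) atTop (𝓝 (Complex.I * x * k)) := by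
    intro k
    refine (Lx.mul_const (k : ℂ)).congr fun n => by ring
  -- second order terms
  have Lre : Tendsto (fun n : ℕ => ((Real.sqrt n : ℝ) : ℂ) *
      (r n * (Complex.exp (Complex.I * ((((Real.sqrt n)⁻¹ : ℝ) : ℂ) * x)) - 1))) atTop
      (𝓝 (lam * (Complex.I * x))) := by
    refine (hrc.mul (exp_first _ _ Lx)).congr fun n => by ring
  have A1 := exp_second _ _ Lre
  have A2 := hrc.mul (exp_second _ _ Lx)
  have A3 := exp_second _ _ Lm
  have A4 : Tendsto (fun n : ℕ => ∑ k ∈ Finset.range (K + 1), (poissonProb (r n) k : ℂ) *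
      ((n : ℂ) * (Complex.exp (Complex.I * ((((Real.sqrt n)⁻¹ : ℝ) : ℂ) * t k)) - 1
        - Complex.I * ((((Real.sqrt n)⁻¹ : ℝ) : ℂ) * t k)))) atTop
      (𝓝 (∑ k ∈ Finset.range (K + 1), (poissonProb lam k : ℂ) * ((Complex.I * t k) ^ 2 / 2))) :=
    tendsto_finsetSum _ fun k _ => (hpc k).mul (exp_second _ _ (Lt k))
  have A5 : Tendsto (fun n : ℕ => ∑ k ∈ Finset.range (K + 1), (poissonProb (r n) k : ℂ) *
      ((((Real.sqrt n : ℝ) : ℂ) * (Complex.exp (Complex.I * ((((Real.sqrt n)⁻¹ : ℝ) : ℂ) * t k)) - 1))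
        * (((Real.sqrt n : ℝ) : ℂ) *
          (Complex.exp (Complex.I * ((((Real.sqrt n)⁻¹ : ℝ) : ℂ) * x) * k) - 1)))) atTop
      (𝓝 (∑ k ∈ Finset.range (K + 1), (poissonProb lam k : ℂ) *
        ((Complex.I * t k) * (Complex.I * x * k)))) :=
    tendsto_finsetSum _ fun k _ =>
      (hpc k).mul ((exp_first _ _ (Lt k)).mul (exp_first _ _ (Lxk k)))
  have hpre : Tendsto (fun n : ℕ => Complex.exp (-(Complex.I * ((((Real.sqrt n)⁻¹ : ℝ) : ℂ) *
      (mu K t (r n) + x * r n))))) atTop (𝓝 1) := by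
    have h1 := (((hsi.mul (hmu.add (hrc.const_mul (x : ℂ)))).const_mul Complex.I).neg)
    have := (Complex.continuous_exp.tendsto _).comp h1
    simpa [Function.comp_def] using this
  have hall := hpre.mul ((((A1.add A2).add A4).add A5).sub A3)
  have hlim : Tendsto (fun n : ℕ => (n : ℂ) * (Fn K t (r n) (Real.sqrt n)⁻¹ x - 1)) atTop
      (𝓝 (-(quad K t lam x / 2 : ℝ))) := by
    convert! hall using 1
    · funext n
      rw [Fn_eq]
      set ε : ℂ := (((Real.sqrt n)⁻¹ : ℝ) : ℂ) with hε
      have hP := Complex.exp_ne_zero (Complex.I * (ε * (mu K t (r n) + x * r n)))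
      rw [Complex.exp_neg]
      have hmus : (mu K t (r n) : ℂ) = ∑ k ∈ Finset.range (K + 1), (poissonProb (r n) k : ℂ) * t k := by
        unfold mu; push_cast; rfl
      have e4 : ∑ k ∈ Finset.range (K + 1), (poissonProb (r n) k : ℂ) *
          ((n : ℂ) * (Complex.exp (Complex.I * (ε * t k)) - 1 - Complex.I * (ε * t k))) =
          ∑ k ∈ Finset.range (K + 1), (poissonProb (r n) k : ℂ) *
          ((n : ℂ) * (Complex.exp (Complex.I * (ε * t k)) - 1)) -
          n * Complex.I * ε * mu K t (r n) := by
        rw [hmus, Finset.mul_sum, ← Finset.sum_sub_distrib]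
        exact Finset.sum_congr rfl fun k _ => by ring
      have e5 : ∑ k ∈ Finset.range (K + 1), (poissonProb (r n) k : ℂ) *
          ((((Real.sqrt n : ℝ) : ℂ) * (Complex.exp (Complex.I * (ε * t k)) - 1))
          * (((Real.sqrt n : ℝ) : ℂ) * (Complex.exp (Complex.I * (ε * x) * k) - 1))) =
          n * ∑ k ∈ Finset.range (K + 1), (poissonProb (r n) k : ℂ) *
            (Complex.exp (Complex.I * (ε * t k)) - 1) * Complex.exp (Complex.I * (ε * x) * k) -
          ∑ k ∈ Finset.range (K + 1), (poissonProb (r n) k : ℂ) *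
          ((n : ℂ) * (Complex.exp (Complex.I * (ε * t k)) - 1)) := by
        rw [Finset.mul_sum, ← Finset.sum_sub_distrib]
        refine Finset.sum_congr rfl fun k _ => ?_
        rw [← hsq n]; ring
      rw [e4, e5]
      field_simp
      ring
    · congr 1
      have hI := Complex.I_sq
      have s4 : ∑ k ∈ Finset.range (K + 1), (poissonProb lam k : ℂ) * ((Complex.I * t k) ^ 2 / 2)
          = -(∑ k ∈ Finset.range (K + 1), (poissonProb lam k : ℂ) * t k ^ 2) / 2 := by
        rw [neg_div, Finset.sum_div, ← Finset.sum_neg_distrib]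
        refine Finset.sum_congr rfl fun k _ => ?_
        rw [mul_pow, hI]; ring
      have s5 : ∑ k ∈ Finset.range (K + 1), (poissonProb lam k : ℂ) *
          ((Complex.I * t k) * (Complex.I * x * k)) =
          -x * ∑ k ∈ Finset.range (K + 1), k * (poissonProb lam k : ℂ) * t k := by
        rw [Finset.mul_sum]
        refine Finset.sum_congr rfl fun k _ => ?_
        linear_combination (poissonProb lam k : ℂ) * t k * x * k * hI
      rw [s4, s5]
      unfold quad
      push_cast
      linear_combination (-(lam ^ 2 * x ^ 2 / 2 + lam * x ^ 2 / 2 - (mu K t lam + x * lam) ^ 2 / 2) : ℂ) * hI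
  have := Complex.tendsto_one_add_pow_exp_of_tendsto hlim
  refine this.congr fun n => ?_
  congr 1
  ring

/-- Scaled Fourier integral. -/
def Jn (K : ℕ) (t : ℕ → ℝ) (r : ℝ) (n : ℕ) : ℂ :=
  ∫ x : ℝ, (Set.Ioc (-(Real.pi * Real.sqrt n)) (Real.pi * Real.sqrt n)).indicator
    (fun x => Fn K t r (Real.sqrt n)⁻¹ x ^ n) x

lemma Fn_continuous (K : ℕ) (t : ℕ → ℝ) (r ε : ℝ) : Continuous (fun x => Fn K t r ε x) := by
  unfold Fn Gf
  fun_prop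

lemma norm_exp_I_real (y : ℂ) (y' : ℝ) (h : y = y') : ‖Complex.exp (Complex.I * y)‖ = 1 := by
  rw [h, mul_comm, Complex.norm_exp_ofReal_mul_I]

lemma Fn_pow_bound (K : ℕ) (t : ℕ → ℝ) (r c x : ℝ) (hr : 0 < r) (hc : c ≤ cc K r) (hc0 : 0 < c)
    (n : ℕ) (hn : 0 < n) (hx : |x| ≤ Real.pi * Real.sqrt n) :
    ‖Fn K t r (Real.sqrt n)⁻¹ x ^ n‖ ≤ Real.exp (-(c * (2 / Real.pi ^ 2)) * x ^ 2) := by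
  have hs : 0 < Real.sqrt n := Real.sqrt_pos.2 (by exact_mod_cast hn)
  have hnR : (0 : ℝ) < n := by exact_mod_cast hn
  have h1 : ‖Fn K t r (Real.sqrt n)⁻¹ x‖ ≤ 1 - cc K r * (1 - Real.cos ((Real.sqrt n)⁻¹ * x)) := by
    unfold Fn
    rw [norm_mul]
    have : ‖Complex.exp (-(Complex.I * ((((Real.sqrt n)⁻¹ : ℝ) : ℂ) * (mu K t r + x * r))))‖ = 1 := by
      rw [← mul_neg]
      exact norm_exp_I_real _ (-((Real.sqrt n)⁻¹ * (mu K t r + x * r))) (by push_cast; ring)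
    rw [this, mul_one]
    refine Gf_bound K _ (fun k => ?_) r _ hr
    exact (norm_exp_I_real _ ((Real.sqrt n)⁻¹ * t k) (by push_cast; ring)).le
  have hab : |(Real.sqrt n)⁻¹ * x| ≤ Real.pi := by
    rw [abs_mul, abs_of_pos (inv_pos.2 hs), inv_mul_le_iff₀ hs]; linarith
  have h2 := Real.cos_le_one_sub_mul_cos_sq hab
  have h3 : c * (2 / Real.pi ^ 2 * ((Real.sqrt n)⁻¹ * x) ^ 2) ≤
      cc K r * (1 - Real.cos ((Real.sqrt n)⁻¹ * x)) := by
    apply mul_le_mul hc (by linarith) (by positivity) (by linarith)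
  have hsq : ((Real.sqrt n)⁻¹) ^ 2 = (n : ℝ)⁻¹ := by
    rw [inv_pow, Real.sq_sqrt hnR.le]
  rw [mul_pow, hsq] at h3
  have h4 : ‖Fn K t r (Real.sqrt n)⁻¹ x‖ ≤
      Real.exp (-(c * (2 / Real.pi ^ 2 * ((n : ℝ)⁻¹ * x ^ 2)))) := by
    have := Real.add_one_le_exp (-(c * (2 / Real.pi ^ 2 * ((n : ℝ)⁻¹ * x ^ 2))))
    linarith
  rw [norm_pow]
  calc _ ≤ Real.exp (-(c * (2 / Real.pi ^ 2 * ((n : ℝ)⁻¹ * x ^ 2)))) ^ n := by gcongr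
    _ = _ := by
      rw [← Real.exp_nat_mul]; congr 1; field_simp

lemma Jn_limit (K : ℕ) (t : ℕ → ℝ) (r : ℕ → ℝ) (lam : ℝ) (hlam : 0 < lam)
    (hr : Tendsto r atTop (𝓝 lam)) :
    Tendsto (fun n => Jn K t (r n) n) atTop
      (𝓝 (∫ x : ℝ, Complex.exp (-(quad K t lam x / 2 : ℝ)))) := by
  set c := cc K lam / 2 with hc
  have hc0 : 0 < c := by have := cc_pos K lam hlam; positivity
  have hev : ∀ᶠ n in atTop, c ≤ cc K (r n) := by
    have := ((cc_cont K lam hlam).tendsto.comp hr)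
    exact (this.eventually (lt_mem_nhds (show c < cc K lam by
      have := cc_pos K lam hlam; linarith))).mono fun n h => le_of_lt h
  have hevr : ∀ᶠ n in atTop, 0 < r n := hr.eventually (lt_mem_nhds hlam)
  unfold Jn
  refine tendsto_integral_filter_of_dominated_convergence
    (fun x => Real.exp (-(c * (2 / Real.pi ^ 2)) * x ^ 2)) ?_ ?_ ?_ ?_
  · refine Eventually.of_forall fun n => ?_
    refine AEStronglyMeasurable.indicator ?_ measurableSet_Ioc
    exact ((Fn_continuous K t _ _).pow n).aestronglyMeasurable
  · filter_upwards [hev, hevr, eventually_gt_atTop 0] with n h1 h2 h3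
    refine Eventually.of_forall fun x => ?_
    by_cases hx : x ∈ Set.Ioc (-(Real.pi * Real.sqrt n)) (Real.pi * Real.sqrt n)
    · rw [Set.indicator_of_mem hx]
      exact Fn_pow_bound K t (r n) c x h2 h1 hc0 n h3 (abs_le.2 ⟨hx.1.le, hx.2⟩)
    · rw [Set.indicator_of_notMem hx, norm_zero]; positivity
  · exact integrable_exp_neg_mul_sq (by positivity)
  · refine Eventually.of_forall fun x => ?_
    refine (Fn_limit K t r lam x hr).congr' ?_
    have hs : Tendsto (fun n : ℕ => Real.pi * Real.sqrt n) atTop atTop :=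
      (Real.tendsto_sqrt_atTop.comp tendsto_natCast_atTop_atTop).const_mul_atTop Real.pi_pos
    filter_upwards [hs.eventually_gt_atTop |x|] with n hn
    rw [Set.indicator_of_mem]
    have := abs_lt.1 hn
    exact ⟨this.1, this.2.le⟩

/-- Completed square. -/
def vlim (K : ℕ) (t : ℕ → ℝ) (lam : ℝ) : ℝ :=
  ∑ k ∈ Finset.range (K + 1), poissonProb lam k * t k ^ 2 - mu K t lam ^ 2 -
    (∑ k ∈ Finset.range (K + 1), k * poissonProb lam k * t k - mu K t lam * lam) ^ 2 / lam

lemma gauss_int (K : ℕ) (t : ℕ → ℝ) (lam : ℝ) (hlam : 0 < lam) :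
    (∫ x : ℝ, Complex.exp (-(quad K t lam x / 2 : ℝ))) =
      Complex.exp (-(vlim K t lam / 2 : ℝ)) * ((Real.sqrt (Real.pi / (lam / 2)) : ℝ) : ℂ) := by
  set C := ∑ k ∈ Finset.range (K + 1), k * poissonProb lam k * t k - mu K t lam * lam with hC
  have h1 : ∀ x : ℝ, Complex.exp (-(quad K t lam x / 2 : ℝ)) =
      (((Real.exp (-(vlim K t lam / 2)) * Real.exp (-(lam / 2) * (x + C / lam) ^ 2) : ℝ)) : ℂ) := by
    intro x
    rw [← Real.exp_add, ← Complex.ofReal_neg, ← Complex.ofReal_exp]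
    congr 2
    unfold quad vlim
    rw [← hC]
    field_simp
    ring
  simp_rw [h1]
  rw [integral_complex_ofReal, integral_const_mul,
    integral_add_right_eq_self (fun x => Real.exp (-(lam / 2) * x ^ 2)), integral_gaussian]
  push_cast
  rfl

lemma Jn_formula (n : ℕ) (hn : 0 < n) (K : ℕ) (t : ℕ → ℝ) (ht : ∀ k, K < k → t k = 0)
    (M : ℕ) (r : ℝ) (hr : 0 < r) (hM : (M : ℝ) = n * r) :
    (avgOp n)^[M] (fun d => ∏ v, Complex.exp (Complex.I * ((((Real.sqrt n)⁻¹ : ℝ) : ℂ) * t (d v)))) 0 *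
      Complex.exp (-(Complex.I * ((Real.sqrt n : ℝ) * mu K t r)))
    = ((M.factorial : ℂ) / ((n : ℂ) ^ M * (r : ℂ) ^ M * (2 * Real.pi))) *
      (Complex.exp (n * r) * ((Real.sqrt n)⁻¹ : ℝ)) * Jn K t r n := by
  have hs : 0 < Real.sqrt n := Real.sqrt_pos.2 (by exact_mod_cast hn)
  have hnR : (0 : ℝ) < n := by exact_mod_cast hn
  have hsC : ((Real.sqrt n : ℝ) : ℂ) ≠ 0 := by exact_mod_cast hs.ne'
  have hsq : ((Real.sqrt n : ℝ) : ℂ) * ((Real.sqrt n : ℝ) : ℂ) = n := by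
    rw [← Complex.ofReal_mul, Real.mul_self_sqrt (Nat.cast_nonneg n)]; simp
  have hMC : (M : ℂ) = n * r := by exact_mod_cast hM
  rw [cauchy_formula n hn K (fun k => Complex.exp (Complex.I * ((((Real.sqrt n)⁻¹ : ℝ) : ℂ) * t k)))
    (fun k hk => by simp [ht k hk]) M r hr]
  generalize ((M.factorial : ℂ) / ((n : ℂ) ^ M * (r : ℂ) ^ M * (2 * Real.pi))) = A
  rw [mul_assoc A, mul_assoc A]
  congr 1
  unfold Jn
  rw [integral_indicator measurableSet_Ioc, ← intervalIntegral.integral_of_le (by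
    have := Real.pi_pos; nlinarith [mul_pos this hs])]
  have hsub := intervalIntegral.integral_comp_mul_left
    (a := -(Real.pi * Real.sqrt n)) (b := Real.pi * Real.sqrt n)
    (fun θ : ℝ => Gf K (fun k => Complex.exp (Complex.I * ((((Real.sqrt n)⁻¹ : ℝ) : ℂ) * t k))) 0
      (r * Complex.exp (θ * Complex.I)) ^ n * Complex.exp (-(M * θ * Complex.I)))
    (inv_ne_zero hs.ne')
  have b1 : (Real.sqrt n)⁻¹ * -(Real.pi * Real.sqrt n) = -Real.pi := by field_simp
  have b2 : (Real.sqrt n)⁻¹ * (Real.pi * Real.sqrt n) = Real.pi := by field_simp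
  rw [b1, b2, inv_inv] at hsub
  have hF : ∀ x : ℝ, Fn K t r (Real.sqrt n)⁻¹ x ^ n =
      (Complex.exp (-(n * r)) * Complex.exp (-(Complex.I * ((Real.sqrt n : ℝ) * mu K t r)))) *
      (Gf K (fun k => Complex.exp (Complex.I * ((((Real.sqrt n)⁻¹ : ℝ) : ℂ) * t k))) 0
      (r * Complex.exp (((Real.sqrt n)⁻¹ * x : ℝ) * Complex.I)) ^ n *
        Complex.exp (-(M * ((Real.sqrt n)⁻¹ * x : ℝ) * Complex.I))) := by
    intro x
    unfold Fn
    rw [mul_pow, mul_pow, Complex.ofReal_exp, ← Complex.exp_nat_mul, ← Complex.exp_nat_mul]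
    have e1 : (n : ℂ) * ((-r : ℝ) : ℂ) = -(n * r) := by push_cast; ring
    have e2 : (n : ℂ) * -(Complex.I * ((((Real.sqrt n)⁻¹ : ℝ) : ℂ) * (mu K t r + x * r))) =
        -(Complex.I * ((Real.sqrt n : ℝ) * mu K t r)) +
          -(M * ((Real.sqrt n)⁻¹ * x : ℝ) * Complex.I) := by
      rw [hMC, ← hsq]; push_cast; field_simp; ring
    rw [e1, e2, Complex.exp_add]
    ring
  simp_rw [hF]
  rw [intervalIntegral.integral_const_mul, hsub, Complex.real_smul]
  have hE : Complex.exp (n * r) * Complex.exp (-(n * r)) = 1 := by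
    rw [← Complex.exp_add]; simp
  set Q := ∫ θ in (-Real.pi)..Real.pi, Gf K (fun k => Complex.exp (Complex.I *
    ((((Real.sqrt n)⁻¹ : ℝ) : ℂ) * t k))) 0 (r * Complex.exp (θ * Complex.I)) ^ n *
    Complex.exp (-(M * θ * Complex.I))
  have hi : (((Real.sqrt n)⁻¹ : ℝ) : ℂ) * ((Real.sqrt n : ℝ) : ℂ) = 1 := by
    push_cast; field_simp
  linear_combination (-(Q * Complex.exp (-(Complex.I * ((Real.sqrt n : ℝ) * mu K t r)))) *
    ((((Real.sqrt n)⁻¹ : ℝ) : ℂ) * ((Real.sqrt n : ℝ) : ℂ))) * hE -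
    (Q * Complex.exp (-(Complex.I * ((Real.sqrt n : ℝ) * mu K t r)))) * hi

lemma avgOp_iter_one (n : ℕ) (hn : 0 < n) (M : ℕ) : (avgOp n)^[M] (fun _ => 1) = fun _ => 1 := by
  induction M with
  | zero => rfl
  | succ M ih =>
    rw [Function.iterate_succ_apply', ih]
    funext d
    have : (n : ℂ) ≠ 0 := by exact_mod_cast hn.ne'
    simp [avgOp, this]

lemma balls_limit (K : ℕ) (t : ℕ → ℝ) (ht : ∀ k, K < k → t k = 0) (M : ℕ → ℕ) (lam : ℝ)
    (hlam : 0 < lam) (hr : Tendsto (fun n => (M n : ℝ) / n) atTop (𝓝 lam)) :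
    Tendsto (fun n => (avgOp n)^[M n] (fun d => ∏ v, Complex.exp (Complex.I *
        ((((Real.sqrt n)⁻¹ : ℝ) : ℂ) * t (d v)))) 0 *
      Complex.exp (-(Complex.I * ((Real.sqrt n : ℝ) * mu K t ((M n : ℝ) / n))))) atTop
      (𝓝 (Complex.exp (-(vlim K t lam / 2 : ℝ)))) := by
  have h1 := Jn_limit K t _ lam hlam hr
  have h0 := Jn_limit K (fun _ => 0) _ lam hlam hr
  rw [gauss_int K _ lam hlam] at h1 h0
  have hv0 : vlim K (fun _ => 0) lam = 0 := by simp [vlim, mu]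
  have hg : ((Real.sqrt (Real.pi / (lam / 2)) : ℝ) : ℂ) ≠ 0 := by
    have : 0 < Real.sqrt (Real.pi / (lam / 2)) := Real.sqrt_pos.2 (by positivity)
    exact_mod_cast this.ne'
  rw [hv0] at h0
  simp only [zero_div, Complex.ofReal_zero, neg_zero, Complex.exp_zero, one_mul] at h0
  have h2 := h1.div h0 hg
  rw [mul_div_cancel_right₀ _ hg] at h2
  refine h2.congr' ?_
  filter_upwards [eventually_gt_atTop 0, hr.eventually (lt_mem_nhds hlam),
    h0.eventually_ne hg] with n hn hrn hJ
  have hnR : (n : ℝ) ≠ 0 := by positivity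
  have hM : (M n : ℝ) = n * ((M n : ℝ) / n) := by field_simp
  have f1 := Jn_formula n hn K t ht (M n) _ hrn hM
  have f0 := Jn_formula n hn K (fun _ => 0) (fun _ _ => rfl) (M n) _ hrn hM
  have hmu0 : mu K (fun _ => 0) ((M n : ℝ) / n) = 0 := by simp [mu]
  rw [hmu0] at f0
  simp only [Complex.ofReal_zero, mul_zero, Complex.exp_zero, Finset.prod_const_one, neg_zero,
    mul_one, avgOp_iter_one n hn] at f0
  rw [f1, Pi.div_apply, div_eq_iff hJ]
  linear_combination Jn K t ((M n : ℝ) / n) n * f0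

/-- The test function used in the comparison. -/
def testH (n : ℕ) (t : ℕ → ℝ) : (Fin n → ℕ) → ℂ :=
  fun d => ∏ v, Complex.exp (Complex.I * ((((Real.sqrt n)⁻¹ : ℝ) : ℂ) * t (d v)))

lemma testH_eq (n : ℕ) (t : ℕ → ℝ) (d : Fin n → ℕ) :
    testH n t d = Complex.exp (Complex.I * (((Real.sqrt n)⁻¹ * ∑ v, t (d v) : ℝ) : ℂ)) := by
  unfold testH
  rw [← Complex.exp_sum]
  congr 1
  push_cast
  rw [← Finset.mul_sum, ← Finset.mul_sum]

lemma exp_I_lip (x y : ℝ) :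
    ‖Complex.exp (Complex.I * x) - Complex.exp (Complex.I * y)‖ ≤ |x - y| := by
  have h : Complex.exp (Complex.I * x) - Complex.exp (Complex.I * y)
      = Complex.exp (Complex.I * y) * (Complex.exp (Complex.I * ((x - y : ℝ) : ℂ)) - 1) := by
    rw [mul_sub, ← Complex.exp_add]
    push_cast
    ring_nf
  rw [h, norm_mul, norm_exp_I_real _ y rfl, one_mul]
  exact Real.norm_exp_I_mul_ofReal_sub_one_le

lemma testH_lip (n : ℕ) (t : ℕ → ℝ) (B : ℝ) (hB : ∀ k, |t k| ≤ B) :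
    LipBall n ((Real.sqrt n)⁻¹ * (2 * B)) (testH n t) := by
  intro d u
  rw [testH_eq, testH_eq]
  refine (exp_I_lip _ _).trans ?_
  rw [← mul_sub, abs_mul, abs_of_nonneg (by positivity)]
  refine mul_le_mul_of_nonneg_left ?_ (by positivity)
  rw [← Finset.sum_sub_distrib, Finset.sum_eq_single u]
  · have h1 := hB ((d + Pi.single u 1 : Fin n → ℕ) u)
    have h2 := hB (d u)
    have := abs_sub (t ((d + Pi.single u 1 : Fin n → ℕ) u)) (t (d u))
    linarith
  · intro v _ hv
    simp [Pi.single_eq_of_ne hv]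
  · simp

lemma eventually_le_card (m : ℕ → ℕ) (lam : ℝ)
    (hconv : Tendsto (fun n => 2 * (m n : ℝ) / n) atTop (𝓝 lam)) :
    ∀ᶠ n in atTop, m n ≤ Fintype.card (EdgeIdx n) := by
  have h1 : ∀ᶠ n in atTop, 2 * (m n : ℝ) / n < lam + 1 :=
    hconv.eventually (gt_mem_nhds (by linarith))
  have h2 : ∀ᶠ n : ℕ in atTop, lam + 2 ≤ (n : ℝ) :=
    tendsto_natCast_atTop_atTop.eventually_ge_atTop _
  filter_upwards [h1, h2, eventually_gt_atTop 0] with n h1 h2 hn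
  have hnR : (0 : ℝ) < n := by exact_mod_cast hn
  rw [div_lt_iff₀ hnR] at h1
  have h3 := card_edge n
  have : (m n : ℝ) ≤ Fintype.card (EdgeIdx n) := by nlinarith
  exact_mod_cast this

lemma avgG_limit (K : ℕ) (t : ℕ → ℝ) (ht : ∀ k, K < k → t k = 0)
    (m : ℕ → ℕ) (lam : ℝ) (hlam : 0 < lam)
    (hconv : Tendsto (fun n => 2 * (m n : ℝ) / n) atTop (𝓝 lam)) :
    Tendsto (fun n : ℕ => avgG n (m n) (testH n t) *
      Complex.exp (-(Complex.I * ((Real.sqrt n : ℝ) * mu K t (2 * (m n : ℝ) / n))))) atTop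
      (𝓝 (Complex.exp (-(vlim K t lam / 2 : ℝ)))) := by
  have hb := balls_limit K t ht (fun n => 2 * m n) lam hlam (by
    push_cast; exact hconv)
  simp only [Nat.cast_mul, Nat.cast_ofNat] at hb
  set B : ℝ := ∑ k ∈ Finset.range (K + 1), |t k| with hBdef
  have hB : ∀ k, |t k| ≤ B := by
    intro k
    by_cases hk : K < k
    · rw [ht k hk, abs_zero]; positivity
    · exact Finset.single_le_sum (f := fun k => |t k|) (fun _ _ => abs_nonneg _)
        (Finset.mem_range.2 (by omega))
  have herr : Tendsto (fun n : ℕ => (2 * (m n : ℝ) / n) * (4 * B * (1 + 2 * (m n : ℝ) / n)) *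
      (Real.sqrt n)⁻¹) atTop (𝓝 (lam * (4 * B * (1 + lam)) * 0)) := by
    refine (hconv.mul ((hconv.const_add 1).const_mul _)).mul ?_
    exact tendsto_inv_atTop_zero.comp (Real.tendsto_sqrt_atTop.comp tendsto_natCast_atTop_atTop)
  rw [mul_zero] at herr
  have hd : Tendsto (fun n : ℕ => avgG n (m n) (testH n t) *
      Complex.exp (-(Complex.I * ((Real.sqrt n : ℝ) * mu K t (2 * (m n : ℝ) / n))))
      - (avgOp n)^[2 * m n] (testH n t) 0 *
      Complex.exp (-(Complex.I * ((Real.sqrt n : ℝ) * mu K t (2 * (m n : ℝ) / n))))) atTop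
      (𝓝 0) := by
    refine squeeze_zero_norm' ?_ herr
    filter_upwards [eventually_le_card m lam hconv, eventually_gt_atTop 0] with n hm hn
    have hnR : (0 : ℝ) < n := by exact_mod_cast hn
    rw [← sub_mul, norm_mul, ← mul_neg, norm_exp_I_real _
      (-(Real.sqrt n * mu K t (2 * (m n : ℝ) / n))) (by push_cast; rfl), mul_one]
    refine (gnm_compare n (m n) hn hm (testH_lip n t B hB)).trans (le_of_eq ?_)
    field_simp
  have := hd.add hb
  rw [zero_add] at this
  refine this.congr fun n => ?_
  unfold testH
  ring

lemma gnm_integral (n r : ℕ) (f : (EdgeIdx n → Bool) → ℂ) :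
    ∫ S, f S ∂(gnmMeasure n r) = ((Finset.univ.filter
      (fun S : EdgeIdx n → Bool => edgeCount n S = r)).card : ℂ)⁻¹ *
      ∑ S ∈ Finset.univ.filter (fun S : EdgeIdx n → Bool => edgeCount n S = r), f S := by
  unfold gnmMeasure
  rw [integral_finsetSum_measure]
  · simp_rw [integral_smul_measure, integral_dirac]
    rw [Finset.mul_sum, Finset.sum_filter]
    refine Finset.sum_congr rfl fun S _ => ?_
    split_ifs with h
    · rw [ENNReal.toReal_inv]; simp
    · simp
  · intro S _
    refine Integrable.smul_measure ?_ ?_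
    · exact integrable_dirac (by simp)
    · split_ifs with h
      · refine ENNReal.inv_ne_top.2 ?_
        have : 0 < (Finset.univ.filter
          (fun S : EdgeIdx n → Bool => edgeCount n S = r)).card :=
          Finset.card_pos.2 ⟨S, by simp [h]⟩
        exact_mod_cast this.ne'
      · simp

lemma gnm_prob (n r : ℕ) (hr : r ≤ Fintype.card (EdgeIdx n)) :
    IsProbabilityMeasure (gnmMeasure n r) := by
  constructor
  unfold gnmMeasure
  have := graph_card_pos n r hr
  simp only [Measure.coe_finsetSum, Finset.sum_apply, Measure.smul_apply, measure_univ,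
    smul_eq_mul, mul_one]
  rw [← Finset.sum_filter, Finset.sum_const, nsmul_eq_mul]
  exact ENNReal.mul_inv_cancel (by exact_mod_cast this.ne') (by simp)

/-- The normalised degree counts. -/
def Xn (K n : ℕ) (lamn : ℝ) (S : EdgeIdx n → Bool) : Fin (K + 1) → ℝ :=
  fun k : Fin (K + 1) => (Real.sqrt n)⁻¹ *
            ((degCount n k S : ℝ) - n * poissonProb lamn k)

/-- Extension by zero. -/
def ext0 (K : ℕ) (s : Fin (K + 1) → ℝ) (k : ℕ) : ℝ := if h : k < K + 1 then s ⟨k, h⟩ else 0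

lemma ext0_coe (K : ℕ) (s : Fin (K + 1) → ℝ) (k : Fin (K + 1)) : ext0 K s k = s k := by
  unfold ext0
  rw [dif_pos k.2]

lemma mu_ext0 (K : ℕ) (s : Fin (K + 1) → ℝ) (r : ℝ) :
    mu K (ext0 K s) r = ∑ k : Fin (K + 1), poissonProb r k * s k := by
  unfold mu
  rw [Finset.sum_range]
  simp_rw [ext0_coe]

lemma sum_degCount (K n : ℕ) (s : Fin (K + 1) → ℝ) (S : EdgeIdx n → Bool) :
    ∑ k : Fin (K + 1), (degCount n k S : ℝ) * s k = ∑ v, ext0 K s (degree n S v) := by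
  have h1 : ∀ v, ext0 K s (degree n S v)
      = ∑ k : Fin (K + 1), if degree n S v = k then s k else 0 := by
    intro v
    unfold ext0
    split_ifs with h
    · rw [Finset.sum_eq_single ⟨degree n S v, h⟩]
      · simp
      · intro b _ hb
        rw [if_neg]
        intro h'
        exact hb (Fin.ext h'.symm)
      · simp
    · refine (Finset.sum_eq_zero fun k _ => ?_).symm
      rw [if_neg]
      have := k.2
      omega
  simp_rw [h1]
  rw [Finset.sum_comm]
  refine Finset.sum_congr rfl fun k _ => ?_
  rw [← Finset.sum_filter, Finset.sum_const, nsmul_eq_mul]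
  rfl

lemma charFun_Xn (K n r : ℕ) (hn : 0 < n) (lamn : ℝ) (s : EuclideanSpace ℝ (Fin (K + 1))) :
    charFun ((gnmMeasure n r).map (fun S => WithLp.toLp 2 (Xn K n lamn S))) s
    = avgG n r (testH n (ext0 K s)) *
      Complex.exp (-(Complex.I * ((Real.sqrt n : ℝ) * mu K (ext0 K s) lamn))) := by
  rw [charFun_apply, integral_map (Measurable.of_discrete).aemeasurable
    (by fun_prop), gnm_integral]
  unfold avgG
  rw [mul_assoc, Finset.sum_mul]
  congr 1
  refine Finset.sum_congr rfl fun S _ => ?_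
  rw [testH_eq, ← Complex.exp_add]
  congr 1
  have hs : 0 < Real.sqrt n := Real.sqrt_pos.2 (by exact_mod_cast hn)
  have : inner ℝ (WithLp.toLp 2 (Xn K n lamn S)) s
      = (Real.sqrt n)⁻¹ * (∑ v, ext0 K s (degree n S v)) - Real.sqrt n * mu K (ext0 K s) lamn := by
    rw [← sum_degCount, mu_ext0, PiLp.inner_apply, Finset.mul_sum, Finset.mul_sum,
      ← Finset.sum_sub_distrib]
    refine Finset.sum_congr rfl fun k _ => ?_
    simp only [Xn, RCLike.inner_apply, conj_trivial]
    field_simp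
    rw [Real.sq_sqrt (Nat.cast_nonneg n)]
  rw [this]
  push_cast
  ring

/-- The limiting covariance matrix. -/
def Sig (K : ℕ) (lam : ℝ) : Matrix (Fin (K + 1)) (Fin (K + 1)) ℝ := fun j k =>
  poissonProb lam j * poissonProb lam k *
            (-(((j : ℝ) - lam) * ((k : ℝ) - lam) / lam) - 1) +
          poissonProb lam k * (if j = k then 1 else 0)

lemma Sig_quad (K : ℕ) (lam : ℝ) (s : Fin (K + 1) → ℝ) :
    s ⬝ᵥ (Sig K lam).mulVec s = vlim K (ext0 K s) lam := by
  unfold vlim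
  rw [mu_ext0]
  simp only [Finset.sum_range, ext0_coe]
  set a : Fin (K + 1) → ℝ := fun k => poissonProb lam k * s k
  have h1 : s ⬝ᵥ (Sig K lam).mulVec s = ∑ j, ∑ k, (a j * a k *
      (-(((j : ℝ) - lam) * ((k : ℝ) - lam) / lam) - 1) +
        if j = k then poissonProb lam k * s j * s k else 0) := by
    unfold dotProduct Matrix.mulVec
    refine Finset.sum_congr rfl fun j _ => ?_
    unfold dotProduct
    rw [Finset.mul_sum]
    refine Finset.sum_congr rfl fun k _ => ?_
    simp only [Sig, a]
    split_ifs <;> ring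
  have h2 : ∑ k : Fin (K + 1), (k : ℝ) * poissonProb lam k * s k
      - (∑ k : Fin (K + 1), poissonProb lam k * s k) * lam = ∑ k, a k * ((k : ℝ) - lam) := by
    rw [Finset.sum_mul, ← Finset.sum_sub_distrib]
    refine Finset.sum_congr rfl fun k _ => ?_
    simp only [a]; ring
  rw [h1, h2]
  simp_rw [Finset.sum_add_distrib]
  simp only [Finset.sum_ite_eq, Finset.mem_univ, if_true]
  rw [pow_two (∑ k, a k * ((k : ℝ) - lam)), pow_two (∑ k, a k), Finset.sum_mul_sum,
    Finset.sum_mul_sum, Finset.sum_div]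
  simp_rw [Finset.sum_div]
  have h3 : ∀ j k : Fin (K + 1), a j * a k * (-(((j : ℝ) - lam) * ((k : ℝ) - lam) / lam) - 1)
      = - (a j * (j - lam) * (a k * (k - lam)) / lam) - a j * a k := by
    intro j k; ring
  simp_rw [h3, Finset.sum_sub_distrib, Finset.sum_neg_distrib]
  have h4 : ∑ k : Fin (K + 1), poissonProb lam k * s k * s k
    = ∑ k : Fin (K + 1), poissonProb lam k * s k ^ 2 := by
    refine Finset.sum_congr rfl fun k _ => ?_
    ring
  rw [h4]
  ring

lemma charFun_limit (K : ℕ) (m : ℕ → ℕ) (lam : ℝ) (hlam : 0 < lam)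
    (hconv : Tendsto (fun n => 2 * (m n : ℝ) / n) atTop (𝓝 lam))
    (s : EuclideanSpace ℝ (Fin (K + 1))) :
    Tendsto (fun n : ℕ => charFun ((gnmMeasure n (m n)).map
      (fun S => WithLp.toLp 2 (Xn K n (2 * (m n : ℝ) / n) S))) s) atTop
      (𝓝 (Complex.exp (-(vlim K (ext0 K s) lam / 2 : ℝ)))) := by
  refine (avgG_limit K (ext0 K s) ?_ m lam hlam hconv).congr' ?_
  · intro k hk
    unfold ext0
    rw [dif_neg (by omega)]
  · filter_upwards [eventually_gt_atTop 0] with n hn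
    exact (charFun_Xn K n (m n) hn _ s).symm

lemma map_prob (K n r : ℕ) (x : ℝ) (hr : r ≤ Fintype.card (EdgeIdx n)) :
    IsProbabilityMeasure ((gnmMeasure n r).map
      (fun S => WithLp.toLp 2 (Xn K n x S))) := by
  have := gnm_prob n r hr
  exact Measure.isProbabilityMeasure_map (Measurable.of_discrete).aemeasurable

lemma Sig_posSemidef (K : ℕ) (m : ℕ → ℕ) (lam : ℝ) (hlam : 0 < lam)
    (hconv : Tendsto (fun n => 2 * (m n : ℝ) / n) atTop (𝓝 lam)) :
    (Sig K lam).PosSemidef := by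
  refine Matrix.PosSemidef.of_dotProduct_mulVec_nonneg ?_ ?_
  · ext j k
    simp only [Matrix.conjTranspose_apply, star_trivial, Sig]
    by_cases h : j = k
    · subst h; ring
    · rw [if_neg h, if_neg (Ne.symm h)]; ring
  · intro s
    rw [star_trivial, Sig_quad]
    have h := (charFun_limit K m lam hlam hconv (WithLp.toLp 2 s)).norm
    have h1 : ‖Complex.exp (-(vlim K (ext0 K s) lam / 2 : ℝ))‖ ≤ 1 := by
      refine le_of_tendsto h ?_
      filter_upwards [eventually_le_card m lam hconv] with n hn
      have := map_prob K n (m n) (2 * (m n : ℝ) / n) hn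
      exact norm_charFun_le_one _
    rw [← Complex.ofReal_neg, Complex.norm_exp_ofReal, Real.exp_le_one_iff] at h1
    linarith

lemma weak_limit (K : ℕ) (m : ℕ → ℕ) (lam : ℝ) (hlam : 0 < lam)
    (hconv : Tendsto (fun n => 2 * (m n : ℝ) / n) atTop (𝓝 lam))
    (f : BoundedContinuousFunction (EuclideanSpace ℝ (Fin (K + 1))) ℝ) :
    Tendsto (fun n : ℕ => ∫ x, f x ∂((gnmMeasure n (m n)).map
      (fun S => WithLp.toLp 2 (Xn K n (2 * (m n : ℝ) / n) S)))) atTop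
      (𝓝 (∫ x, f x ∂(multivariateGaussian 0 (Sig K lam)))) := by
  classical
  let G : ProbabilityMeasure (EuclideanSpace ℝ (Fin (K + 1))) :=
    ⟨multivariateGaussian 0 (Sig K lam), inferInstance⟩
  let P : ℕ → ProbabilityMeasure (EuclideanSpace ℝ (Fin (K + 1))) := fun n =>
    if h : m n ≤ Fintype.card (EdgeIdx n) then
      ⟨(gnmMeasure n (m n)).map (fun S => WithLp.toLp 2 (Xn K n (2 * (m n : ℝ) / n) S)),
        map_prob K n (m n) _ h⟩ else G
  have hP : ∀ᶠ n in atTop, (P n : Measure (EuclideanSpace ℝ (Fin (K + 1)))) =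
      (gnmMeasure n (m n)).map (fun S => WithLp.toLp 2 (Xn K n (2 * (m n : ℝ) / n) S)) := by
    filter_upwards [eventually_le_card m lam hconv] with n hn
    have e : P n = ⟨(gnmMeasure n (m n)).map
      (fun S => WithLp.toLp 2 (Xn K n (2 * (m n : ℝ) / n) S)), map_prob K n (m n) _ hn⟩ :=
      dif_pos hn
    rw [e]
    rfl
  have hG : Tendsto P atTop (𝓝 G) := by
    refine ProbabilityMeasure.tendsto_of_tendsto_charFun fun s => ?_
    have e : charFun (G : Measure (EuclideanSpace ℝ (Fin (K + 1)))) s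
        = Complex.exp (-(vlim K (ext0 K s) lam / 2 : ℝ)) := by
      change charFun (multivariateGaussian 0 (Sig K lam)) s = _
      rw [charFun_multivariateGaussian (Sig_posSemidef K m lam hlam hconv), Sig_quad]
      simp
    rw [e]
    refine (charFun_limit K m lam hlam hconv s).congr' ?_
    filter_upwards [hP] with n hn
    rw [hn]
  have h := ProbabilityMeasure.tendsto_iff_forall_integral_tendsto.1 hG f
  refine h.congr' ?_
  filter_upwards [hP] with n hn
  rw [hn]

/-- Theorem 4.1(ii): joint asymptotic normality of the numbers of vertices of degree `k`,
`0 ≤ k ≤ K`, in `G(n, m)` with `λₙ := 2m/n → λ > 0`. -/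
theorem gnm_degree_counts_joint_clt
    (m : ℕ → ℕ) (lam : ℝ) (hlam : 0 < lam)
    (hconv : Tendsto (fun n => 2 * (m n : ℝ) / n) atTop (𝓝 lam)) (K : ℕ) :
    ∃ ν : Measure (Fin (K + 1) → ℝ),
      IsProbabilityMeasure ν ∧ IsGaussianMeasure ν ∧
      (∀ k, (∫ x, x k ∂ν) = 0) ∧
      (∀ j k : Fin (K + 1), covFn ν (fun x => x j) (fun x => x k) =
        poissonProb lam j * poissonProb lam k *
            (-(((j : ℝ) - lam) * ((k : ℝ) - lam) / lam) - 1) +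
          poissonProb lam k * (if j = k then 1 else 0)) ∧
      TendstoInDistribution
        (fun n => (gnmMeasure n (m n)).map
          (fun S => fun k : Fin (K + 1) => (Real.sqrt n)⁻¹ *
            ((degCount n k S : ℝ) - n * poissonProb (2 * (m n : ℝ) / n) k)))
        ν := by
  have hPS := Sig_posSemidef K m lam hlam hconv
  have hmeas : Measurable (WithLp.ofLp : EuclideanSpace ℝ (Fin (K + 1)) → Fin (K + 1) → ℝ) := by
    fun_prop
  have hint1 : ∀ k : Fin (K + 1), MemLp (fun x : EuclideanSpace ℝ (Fin (K + 1)) => x k) 2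
      (multivariateGaussian 0 (Sig K lam)) := by
    intro k
    exact IsGaussian.memLp_dual (multivariateGaussian 0 (Sig K lam))
      (EuclideanSpace.proj k : EuclideanSpace ℝ (Fin (K + 1)) →L[ℝ] ℝ) 2 (by simp)
  have hmean : ∀ k : Fin (K + 1),
      ∫ x : EuclideanSpace ℝ (Fin (K + 1)), x k ∂(multivariateGaussian 0 (Sig K lam)) = 0 := by
    intro k
    have := (EuclideanSpace.proj k : EuclideanSpace ℝ (Fin (K + 1)) →L[ℝ] ℝ).integral_comp_comm
      (IsGaussian.integrable_fun_id (μ := multivariateGaussian 0 (Sig K lam)))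
    rw [integral_id_multivariateGaussian, map_zero] at this
    exact this
  have hmapint : ∀ g : (Fin (K + 1) → ℝ) → ℝ, Continuous g →
      ∫ x, g x ∂((multivariateGaussian 0 (Sig K lam)).map WithLp.ofLp)
        = ∫ x : EuclideanSpace ℝ (Fin (K + 1)), g (WithLp.ofLp x)
          ∂(multivariateGaussian 0 (Sig K lam)) := by
    intro g hg
    exact integral_map hmeas.aemeasurable hg.aestronglyMeasurable
  refine ⟨(multivariateGaussian 0 (Sig K lam)).map WithLp.ofLp,
    Measure.isProbabilityMeasure_map hmeas.aemeasurable, ?_, ?_, ?_, ?_⟩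
  · intro L
    rw [Measure.map_map (by fun_prop) hmeas]
    have := IsGaussian.map_eq_gaussianReal (μ := multivariateGaussian 0 (Sig K lam))
      (L.comp (PiLp.continuousLinearEquiv 2 ℝ (fun _ : Fin (K + 1) => ℝ)).toContinuousLinearMap)
    exact ⟨_, _, this⟩
  · intro k
    rw [hmapint _ (by fun_prop)]
    exact hmean k
  · intro j k
    unfold covFn
    rw [hmapint _ (by fun_prop), hmapint _ (by fun_prop), hmapint _ (by fun_prop)]
    have h := covariance_eval_multivariateGaussian (μ := 0) hPS j k
    rw [covariance_eq_sub (hint1 j) (hint1 k)] at h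
    exact h
  · intro f
    rw [hmapint _ f.continuous]
    have h := weak_limit K m lam hlam hconv
      (f.compContinuous ⟨WithLp.ofLp, PiLp.continuous_ofLp 2 _⟩)
    refine h.congr fun n => ?_
    rw [integral_map (Measurable.of_discrete).aemeasurable (by fun_prop),
      integral_map (Measurable.of_discrete).aemeasurable (by fun_prop)]
    rfl
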